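/- Let n ≥ 2 be an integer and λ = (n-1)/2. Define polynomials Q_m(r,t) by Q_1(r,t) = (-(n+3)r + (n-1)r³) + ((n+1) - (n-3)r²)·t and Q_{m+1}(r,t) = (1 - (2λ+2m+1)r² + 2(λ+m)rt)·Q_m(r,t) + (1 + r² - 2rt)·r·∂_r Q_m(r,t). Then for every a > 0, m ∈ ℕ and θ ∈ [0,π], with r = e^{-a}, g_a^m(cos θ) = (a^m/Σ_n) · r · Q_m(r, cos θ) / (1 - 2r cos θ + r²)^{λ+m+1}; moreover Q_m(r,t) has degree at most m in t, and its coefficient as a polynomial in t at t^k is a polynomial in r of degree 2m-k+1 whose monomials r^j all satisfy j ≡ k-1 (mod 2). -/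

import Mathlib

open Real MeasureTheory Set Filter
open scoped RealInnerProductSpace BigOperators

noncomputable def lamb (n : ℕ) : ℝ := ((n : ℝ) - 1) / 2

noncomputable def gegenbauer (lam : ℝ) (l : ℕ) (t : ℝ) : ℝ :=
  ∑ k ∈ Finset.range (l / 2 + 1),
    (-1 : ℝ) ^ k * Real.Gamma ((l : ℝ) - (k : ℝ) + lam) /
      (Real.Gamma lam * (Nat.factorial k : ℝ) * (Nat.factorial (l - 2 * k) : ℝ)) *
      (2 * t) ^ (l - 2 * k)

noncomputable def sigmaN (n : ℕ) : ℝ := 2 * Real.pi ^ (lamb n + 1) / Real.Gamma (lamb n + 1)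

noncomputable def pw (n : ℕ) (a : ℝ) (m : ℕ) (t : ℝ) : ℝ :=
  (1 / sigmaN n) * ∑' l : ℕ, ((lamb n + l) / lamb n) * (a * l) ^ m * Real.exp (-(a * l)) *
    gegenbauer (lamb n) l t

open MvPolynomial in
/-- The bivariate polynomials `Q_m(r,t)` (variable `0` is `r`, variable `1` is `t`). -/
noncomputable def Qpoly (n : ℕ) : ℕ → MvPolynomial (Fin 2) ℝ
  | 0 => 0
  | 1 => C (-((n : ℝ) + 3)) * X 0 + C ((n : ℝ) - 1) * X 0 ^ 3 +
      (C ((n : ℝ) + 1) - C ((n : ℝ) - 3) * X 0 ^ 2) * X 1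
  | (m + 2) =>
      (1 - C (2 * lamb n + 2 * ((m : ℝ) + 1) + 1) * X 0 ^ 2 +
          C (2 * (lamb n + ((m : ℝ) + 1))) * X 0 * X 1) * Qpoly n (m + 1) +
        (1 + X 0 ^ 2 - 2 * X 0 * X 1) * X 0 * pderiv 0 (Qpoly n (m + 1))


/-- support condition -/
def SupOK (m : ℕ) (p : MvPolynomial (Fin 2) ℝ) : Prop :=
  ∀ d ∈ p.support, d 1 ≤ m ∧ d 0 + d 1 ≤ 2 * m + 1 ∧ (d 0 + d 1) % 2 = 1

lemma SupOK.add {m : ℕ} {p q : MvPolynomial (Fin 2) ℝ} (hp : SupOK m p) (hq : SupOK m q) :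
    SupOK m (p + q) := by
  classical
  intro d hd
  rcases Finset.mem_union.1 (MvPolynomial.support_add hd) with h | h
  · exact hp d h
  · exact hq d h

lemma SupOK.cmul {m : ℕ} {p : MvPolynomial (Fin 2) ℝ} (c : ℝ) (hp : SupOK m p) :
    SupOK m (MvPolynomial.C c * p) := by
  intro d hd
  apply hp d
  rw [MvPolynomial.mem_support_iff] at hd ⊢
  rw [MvPolynomial.coeff_C_mul] at hd
  exact right_ne_zero_of_mul hd

lemma SupOK.monomial {m : ℕ} (d : Fin 2 →₀ ℕ) (c : ℝ)
    (h : d 1 ≤ m ∧ d 0 + d 1 ≤ 2 * m + 1 ∧ (d 0 + d 1) % 2 = 1) :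
    SupOK m (MvPolynomial.monomial d c) := by
  intro e he
  have := MvPolynomial.support_monomial_subset he
  rw [Finset.mem_singleton] at this
  subst this
  exact h

lemma SupOK.sum {m : ℕ} {ι : Type*} (s : Finset ι) (f : ι → MvPolynomial (Fin 2) ℝ)
    (h : ∀ i ∈ s, SupOK m (f i)) : SupOK m (∑ i ∈ s, f i) := by
  classical
  induction s using Finset.induction_on with
  | empty => intro d hd; simp at hd
  | insert a s ha ih =>
    rw [Finset.sum_insert ha]
    exact (h a (by simp)).add (ih fun i hi => h i (by simp [hi]))

lemma SupOK.mono {m : ℕ} {p : MvPolynomial (Fin 2) ℝ} (hp : SupOK m p) : SupOK (m + 1) p := by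
  intro d hd
  have := hp d hd
  omega

/-- multiplication by a monomial -/
lemma SupOK.mmul {m : ℕ} {p : MvPolynomial (Fin 2) ℝ} (e : Fin 2 →₀ ℕ) (hp : SupOK m p)
    (h : e 1 ≤ 1 ∧ e 0 + e 1 = 2) : SupOK (m + 1) (MvPolynomial.monomial e 1 * p) := by
  classical
  rw [MvPolynomial.as_sum p, Finset.mul_sum]
  apply SupOK.sum
  intro d hd
  rw [MvPolynomial.monomial_mul]
  apply SupOK.monomial
  have := hp d hd
  simp only [Finsupp.add_apply]
  omega

lemma SupOK.euler {m : ℕ} {p : MvPolynomial (Fin 2) ℝ} (hp : SupOK m p) :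
    SupOK m (MvPolynomial.X 0 * MvPolynomial.pderiv 0 p) := by
  classical
  rw [MvPolynomial.as_sum p, map_sum, Finset.mul_sum]
  apply SupOK.sum
  intro d hd
  rw [MvPolynomial.X_mul_pderiv_monomial, ← map_nsmul]
  exact SupOK.monomial _ _ (hp d hd)

lemma mon_X0sq : (MvPolynomial.X 0 ^ 2 : MvPolynomial (Fin 2) ℝ)
    = MvPolynomial.monomial (Finsupp.single 0 2) 1 := by
  rw [MvPolynomial.X_pow_eq_monomial]

lemma mon_X0X1 : (MvPolynomial.X 0 * MvPolynomial.X 1 : MvPolynomial (Fin 2) ℝ)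
    = MvPolynomial.monomial (Finsupp.single 0 1 + Finsupp.single 1 1) 1 := by
  simp [MvPolynomial.X, MvPolynomial.monomial_mul]

lemma SupOK.sq {m : ℕ} {p : MvPolynomial (Fin 2) ℝ} (hp : SupOK m p) :
    SupOK (m + 1) (MvPolynomial.X 0 ^ 2 * p) := by
  rw [mon_X0sq]
  exact hp.mmul _ (by simp)

lemma SupOK.xy {m : ℕ} {p : MvPolynomial (Fin 2) ℝ} (hp : SupOK m p) :
    SupOK (m + 1) (MvPolynomial.X 0 * MvPolynomial.X 1 * p) := by
  rw [mon_X0X1]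
  exact hp.mmul _ (by simp)

lemma Qpoly_supOK (n : ℕ) : ∀ m : ℕ, SupOK (m + 1) (Qpoly n (m + 1))
  | 0 => by
    have h : Qpoly n (0 + 1) =
      MvPolynomial.C (-((n : ℝ) + 3)) * MvPolynomial.monomial (Finsupp.single 0 1) 1
      + MvPolynomial.C ((n : ℝ) - 1) * MvPolynomial.monomial (Finsupp.single 0 3) 1
      + MvPolynomial.C ((n : ℝ) + 1) * MvPolynomial.monomial (Finsupp.single 1 1) 1
      + MvPolynomial.C (-((n : ℝ) - 3)) *
          MvPolynomial.monomial (Finsupp.single 0 2 + Finsupp.single 1 1) 1 := by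
      have e : MvPolynomial.monomial (Finsupp.single (0 : Fin 2) 2 + Finsupp.single 1 1) (1 : ℝ)
        = MvPolynomial.X 0 ^ 2 * MvPolynomial.X 1 := by
        rw [mon_X0sq]; simp [MvPolynomial.X, MvPolynomial.monomial_mul]
      rw [e, ← MvPolynomial.X_pow_eq_monomial, ← MvPolynomial.X_pow_eq_monomial,
        ← MvPolynomial.X_pow_eq_monomial, zero_add, Qpoly, MvPolynomial.C_neg]
      rw [MvPolynomial.C_neg]
      ring
    rw [h]
    refine (((SupOK.cmul _ ?_).add (SupOK.cmul _ ?_)).add (SupOK.cmul _ ?_)).add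
      (SupOK.cmul _ ?_) <;> apply SupOK.monomial <;> simp
  | (m + 1) => by
    have ih := Qpoly_supOK n m
    have h : Qpoly n (m + 1 + 1) = Qpoly n (m + 1)
      + MvPolynomial.C (-(2 * lamb n + 2 * ((m : ℝ) + 1) + 1)) *
          (MvPolynomial.X 0 ^ 2 * Qpoly n (m + 1))
      + MvPolynomial.C (2 * (lamb n + ((m : ℝ) + 1))) *
          (MvPolynomial.X 0 * MvPolynomial.X 1 * Qpoly n (m + 1))
      + MvPolynomial.X 0 * MvPolynomial.pderiv 0 (Qpoly n (m + 1))
      + MvPolynomial.X 0 ^ 2 * (MvPolynomial.X 0 * MvPolynomial.pderiv 0 (Qpoly n (m + 1)))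
      + MvPolynomial.C (-2) * (MvPolynomial.X 0 * MvPolynomial.X 1 *
          (MvPolynomial.X 0 * MvPolynomial.pderiv 0 (Qpoly n (m + 1)))) := by
      have e2 : (MvPolynomial.C (-2 : ℝ) : MvPolynomial (Fin 2) ℝ) = -2 := by
        rw [MvPolynomial.C_neg, map_ofNat]
      rw [Qpoly, e2, MvPolynomial.C_neg]
      ring
    rw [h]
    exact ((((ih.mono.add (ih.sq.cmul _)).add (ih.xy.cmul _)).add ih.euler.mono).add
      ih.euler.sq).add (ih.euler.xy.cmul _)

/-- termwise differentiation of a power series -/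
lemma euler_hasSum (c : ℕ → ℝ) (f f' : ℝ → ℝ)
    (hs : ∀ r, |r| < 1 → HasSum (fun l => c l * r ^ l) (f r))
    (hf : ∀ r, |r| < 1 → HasDerivAt f (f' r) r) :
    ∀ r, |r| < 1 → HasSum (fun l : ℕ => (l : ℝ) * c l * r ^ l) (r * f' r) := by
  intro r hr
  obtain ⟨ρ, h1, h2⟩ := exists_between hr
  obtain ⟨σ, h3, h4⟩ := exists_between h2
  have hρ0 : 0 ≤ ρ := (abs_nonneg r).trans h1.le
  have hσ0 : 0 < σ := hρ0.trans_lt h3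
  -- bounded coefficients
  have hsum := (hs σ (by rwa [abs_of_pos hσ0])).summable
  obtain ⟨M, hM⟩ := (hsum.tendsto_atTop_zero.norm.bddAbove_range)
  have hM' : ∀ l, |c l| * σ ^ l ≤ M := by
    intro l
    have := hM ⟨l, rfl⟩
    simpa [abs_mul, abs_of_pos hσ0] using this
  have hq : ‖ρ / σ‖ < 1 := by
    rw [Real.norm_eq_abs, abs_of_nonneg (by positivity), div_lt_one hσ0]; exact h3
  have hu : Summable (fun l : ℕ => M * ((l : ℝ) * (ρ / σ) ^ (l - 1)) / σ) := by
    apply Summable.div_const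
    apply Summable.mul_left
    rw [← summable_nat_add_iff 1]
    have a1 := summable_pow_mul_geometric_of_norm_lt_one 1 hq
    have a2 := summable_geometric_of_norm_lt_one hq
    refine (a1.add a2).congr fun l => ?_
    simp; ring
  have hbound : ∀ (l : ℕ) (y : ℝ), y ∈ Ioo (-ρ) ρ →
      ‖c l * ((l : ℝ) * y ^ (l - 1))‖ ≤ M * ((l : ℝ) * (ρ / σ) ^ (l - 1)) / σ := by
    intro l y hy
    rcases Nat.eq_zero_or_pos l with rfl | hl
    · simp
    obtain ⟨k, rfl⟩ : ∃ k, l = k + 1 := ⟨l - 1, by omega⟩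
    have hy' : |y| ≤ ρ := abs_le.2 ⟨hy.1.le, hy.2.le⟩
    have hc : |c (k + 1)| ≤ M / σ ^ (k + 1) := by
      rw [le_div_iff₀ (by positivity)]; exact hM' _
    have hyk : |y| ^ k ≤ ρ ^ k := pow_le_pow_left₀ (abs_nonneg _) hy' k
    have hM0 : 0 ≤ M / σ ^ (k + 1) := (abs_nonneg _).trans hc
    simp only [Nat.add_sub_cancel, Real.norm_eq_abs, abs_mul, abs_pow, Nat.abs_cast]
    calc |c (k + 1)| * (((k + 1 : ℕ) : ℝ) * |y| ^ k)
        ≤ M / σ ^ (k + 1) * (((k + 1 : ℕ) : ℝ) * ρ ^ k) := by gcongr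
      _ = _ := by rw [div_pow]; field_simp; ring
  have hrmem : r ∈ Ioo (-ρ) ρ := abs_lt.1 h1
  have hd := hasDerivAt_tsum_of_isPreconnected (g := fun l y => c l * y ^ l)
    (g' := fun l y => c l * ((l : ℝ) * y ^ (l - 1))) hu isOpen_Ioo isPreconnected_Ioo
    (fun l y _ => (hasDerivAt_pow l y).const_mul (c l)) hbound hrmem (hs r hr).summable hrmem
  have heq : (fun z => ∑' l, c l * z ^ l) =ᶠ[nhds r] f := by
    have : Ioo (-1 : ℝ) 1 ∈ nhds r := isOpen_Ioo.mem_nhds (abs_lt.1 hr)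
    filter_upwards [this] with z hz
    exact (hs z (abs_lt.2 hz)).tsum_eq
  have huniq := (hd.congr_of_eventuallyEq heq.symm).unique (hf r hr)
  have hs' : Summable (fun l => c l * ((l : ℝ) * r ^ (l - 1))) :=
    Summable.of_norm_bounded hu (fun l => hbound l r hrmem)
  have := hs'.hasSum.mul_left r
  rw [huniq] at this
  have e : (fun l : ℕ => (l : ℝ) * c l * r ^ l)
      = fun l : ℕ => r * (c l * ((l : ℝ) * r ^ (l - 1))) := by
    funext l
    rcases Nat.eq_zero_or_pos l with rfl | hl
    · simp
    · obtain ⟨k, rfl⟩ : ∃ k, l = k + 1 := ⟨l - 1, by omega⟩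
      simp only [Nat.add_sub_cancel]; ring
  rw [e]
  exact this

/-- summand of the Gegenbauer polynomial, extended by zero -/
noncomputable def gegTerm (lam t : ℝ) (l k : ℕ) : ℝ :=
  if 2 * k ≤ l then
    (-1 : ℝ) ^ k * Real.Gamma ((l : ℝ) - (k : ℝ) + lam) /
      (Real.Gamma lam * (Nat.factorial k : ℝ) * (Nat.factorial (l - 2 * k) : ℝ)) *
      (2 * t) ^ (l - 2 * k) else 0

lemma gegenbauer_eq (lam t : ℝ) (l N : ℕ) (h : l / 2 + 1 ≤ N) :
    gegenbauer lam l t = ∑ k ∈ Finset.range N, gegTerm lam t l k := by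
  rw [gegenbauer, ← Finset.sum_subset (Finset.range_mono h)]
  · apply Finset.sum_congr rfl
    intro k hk
    rw [Finset.mem_range] at hk
    rw [gegTerm, if_pos (by omega)]
  · intro k _ hk
    rw [Finset.mem_range] at hk
    rw [gegTerm, if_neg (by omega)]

lemma gegTerm_zero_rec (lam t : ℝ) (hl : 0 < lam) (l : ℕ) :
    ((l : ℝ) + 2) * gegTerm lam t (l + 2) 0 = 2 * t * (l + 1 + lam) * gegTerm lam t (l + 1) 0 := by
  have hG : Real.Gamma ((l : ℝ) + 1 + lam + 1) = (l + 1 + lam) * Real.Gamma (l + 1 + lam) :=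
    Real.Gamma_add_one (by positivity)
  have hg : Real.Gamma lam ≠ 0 := (Real.Gamma_pos_of_pos hl).ne'
  have hf := Nat.factorial_ne_zero (l + 1)
  simp only [gegTerm, Nat.mul_zero, Nat.zero_le, if_true, Nat.sub_zero, pow_zero, Nat.factorial_zero]
  rw [show (((l + 2 : ℕ) : ℝ) - ((0 : ℕ) : ℝ) + lam) = (l : ℝ) + 1 + lam + 1 by push_cast; ring,
    show (((l + 1 : ℕ) : ℝ) - ((0 : ℕ) : ℝ) + lam) = (l : ℝ) + 1 + lam by push_cast; ring, hG,
    Nat.factorial_succ (l + 1)]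
  push_cast
  have : (l : ℝ) + 1 + 1 ≠ 0 := by positivity
  field_simp
  ring

lemma gegTerm_rec (lam t : ℝ) (hl : 0 < lam) (l k : ℕ) :
    ((l : ℝ) + 2) * gegTerm lam t (l + 2) (k + 1)
      = 2 * t * (l + 1 + lam) * gegTerm lam t (l + 1) (k + 1)
        - (l + 2 * lam) * gegTerm lam t l k := by
  have hg : Real.Gamma lam ≠ 0 := (Real.Gamma_pos_of_pos hl).ne'
  by_cases h : 2 * k ≤ l
  · obtain ⟨s, rfl⟩ := Nat.exists_eq_add_of_le h
    have hG : Real.Gamma ((k : ℝ) + s + lam + 1) = (k + s + lam) * Real.Gamma (k + s + lam) :=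
      Real.Gamma_add_one (by positivity)
    have hk := Nat.factorial_ne_zero k
    have hk1 : (k : ℝ) + 1 ≠ 0 := by positivity
    rcases s with _ | s
    · simp only [gegTerm]
      rw [if_pos (by omega), if_neg (by omega), if_pos (by omega)]
      rw [show 2 * k + 0 + 2 - 2 * (k + 1) = 0 by omega, show 2 * k + 0 - 2 * k = 0 by omega,
        Nat.factorial_succ k]
      rw [show ((2 * k + 0 + 2 : ℕ) : ℝ) - ((k + 1 : ℕ) : ℝ) + lam
        = (k : ℝ) + (0 : ℕ) + lam + 1 by push_cast; ring, hG,
        show ((2 * k + 0 : ℕ) : ℝ) - (k : ℝ) + lam = (k : ℝ) + (0 : ℕ) + lam by push_cast; ring]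
      push_cast
      field_simp
      ring
    · simp only [gegTerm]
      rw [if_pos (by omega), if_pos (by omega), if_pos (by omega)]
      rw [show 2 * k + (s + 1) + 2 - 2 * (k + 1) = s + 1 by omega,
        show 2 * k + (s + 1) + 1 - 2 * (k + 1) = s by omega,
        show 2 * k + (s + 1) - 2 * k = s + 1 by omega,
        Nat.factorial_succ k, Nat.factorial_succ s]
      rw [show ((2 * k + (s + 1) + 2 : ℕ) : ℝ) - ((k + 1 : ℕ) : ℝ) + lam
        = (k : ℝ) + (s + 1 : ℕ) + lam + 1 by push_cast; ring, hG,
        show ((2 * k + (s + 1) + 1 : ℕ) : ℝ) - ((k + 1 : ℕ) : ℝ) + lam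
        = (k : ℝ) + (s + 1 : ℕ) + lam by push_cast; ring,
        show ((2 * k + (s + 1) : ℕ) : ℝ) - (k : ℝ) + lam
        = (k : ℝ) + (s + 1 : ℕ) + lam by push_cast; ring]
      have hs := Nat.factorial_ne_zero s
      have hs1 : (s : ℝ) + 1 ≠ 0 := by positivity
      generalize Real.Gamma ((k : ℝ) + (s + 1 : ℕ) + lam) = gam
      push_cast
      field_simp
      ring
  · simp only [gegTerm]
    rw [if_neg (by omega), if_neg (by omega), if_neg (by omega)]
    ring

lemma gegenbauer_rec (lam t : ℝ) (hl : 0 < lam) (l : ℕ) :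
    ((l : ℝ) + 2) * gegenbauer lam (l + 2) t
      = 2 * t * (l + 1 + lam) * gegenbauer lam (l + 1) t - (l + 2 * lam) * gegenbauer lam l t := by
  rw [gegenbauer_eq lam t (l + 2) (l + 3) (by omega), gegenbauer_eq lam t (l + 1) (l + 3) (by omega),
    gegenbauer_eq lam t l (l + 2) (by omega), Finset.sum_range_succ' _ (l + 2),
    Finset.sum_range_succ' _ (l + 2), mul_add, mul_add, gegTerm_zero_rec lam t hl, Finset.mul_sum, Finset.mul_sum, Finset.mul_sum,
    Finset.sum_congr rfl (fun k _ => gegTerm_rec lam t hl l k), Finset.sum_sub_distrib]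
  ring

lemma gegenbauer_zero (lam t : ℝ) (hl : 0 < lam) : gegenbauer lam 0 t = 1 := by
  have hg : Real.Gamma lam ≠ 0 := (Real.Gamma_pos_of_pos hl).ne'
  simp [gegenbauer, hg]

lemma gegenbauer_one (lam t : ℝ) (hl : 0 < lam) : gegenbauer lam 1 t = 2 * lam * t := by
  have hg : Real.Gamma lam ≠ 0 := (Real.Gamma_pos_of_pos hl).ne'
  have := Real.Gamma_add_one hl.ne'
  simp [gegenbauer]
  rw [add_comm, this]
  field_simp

/-- binomial coefficients of `(1-x)^(-lam)` -/
noncomputable def bcoef (lam : ℝ) (k : ℕ) : ℂ := Ring.choose ((lam : ℂ) + k - 1) k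

lemma bcoef_zero (lam : ℝ) : bcoef lam 0 = 1 := by
  simp [bcoef]

lemma bcoef_succ (lam : ℝ) (k : ℕ) :
    ((k : ℂ) + 1) * bcoef lam (k + 1) = (lam + k) * bcoef lam k := by
  have h (j : ℕ) : (j.factorial : ℂ) * bcoef lam j = (ascPochhammer ℂ j).eval (lam : ℂ) := by
    rw [bcoef, ← Ring.multichoose_eq, ← nsmul_eq_mul,
      Ring.factorial_nsmul_multichoose_eq_ascPochhammer,
      Polynomial.ascPochhammer_smeval_eq_eval]
  have h1 := h (k + 1)
  rw [ascPochhammer_succ_eval, ← h k, Nat.factorial_succ] at h1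
  have hk : (k.factorial : ℂ) ≠ 0 := by exact_mod_cast Nat.factorial_ne_zero k
  apply mul_left_cancel₀ hk
  push_cast at h1
  linear_combination h1

/-- formal binomial series -/
noncomputable def bser (lam : ℝ) (w : ℂ) : PowerSeries ℂ :=
  PowerSeries.mk fun k => bcoef lam k * w ^ k

lemma bser_deriv (lam : ℝ) (w : ℂ) :
    (1 - PowerSeries.C w * PowerSeries.X) * PowerSeries.derivative ℂ (bser lam w)
      = PowerSeries.C (lam * w) * bser lam w := by
  ext k
  rw [sub_mul, one_mul, map_sub, mul_assoc, PowerSeries.coeff_C_mul, PowerSeries.coeff_C_mul,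
    PowerSeries.coeff_derivative]
  rcases k with _ | k
  · have := bcoef_succ lam 0
    simp [bser] at this ⊢
    rw [this]; ring
  · rw [PowerSeries.coeff_succ_X_mul, PowerSeries.coeff_derivative]
    simp only [bser, PowerSeries.coeff_mk]
    have := bcoef_succ lam (k + 1)
    push_cast at this ⊢
    linear_combination w ^ (k + 1 + 1) * this

lemma prod_coeff (lam : ℝ) (hl : 0 < lam) (t : ℝ) (w v : ℂ) (hwv : w * v = 1)
    (ht : w + v = 2 * t) (l : ℕ) :
    PowerSeries.coeff l (bser lam w * bser lam v) = (gegenbauer lam l t : ℂ) := by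
  set G := bser lam w * bser lam v with hG
  have hd : (1 - PowerSeries.C (2 * t : ℂ) * PowerSeries.X + PowerSeries.X ^ 2)
      * PowerSeries.derivative ℂ G
      = PowerSeries.C (2 * lam * t : ℂ) * G - PowerSeries.C (2 * lam : ℂ) * (PowerSeries.X * G) := by
    have h1 := bser_deriv lam w
    have h2 := bser_deriv lam v
    have e1 : (PowerSeries.C w * PowerSeries.C v : PowerSeries ℂ) = 1 := by
      rw [← map_mul, hwv, map_one]
    have e2 : (PowerSeries.C w + PowerSeries.C v : PowerSeries ℂ) = PowerSeries.C (2 * t : ℂ) := by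
      rw [← map_add, ht]
    have e3 : PowerSeries.C (2 * lam * t : ℂ) = PowerSeries.C (lam : ℂ) * PowerSeries.C (2 * t : ℂ) := by
      rw [← map_mul]; congr 1; ring
    have e4 : PowerSeries.C (2 * lam : ℂ) = 2 * PowerSeries.C (lam : ℂ) := by
      rw [map_mul, map_ofNat]
    rw [map_mul] at h1 h2
    rw [hG, Derivation.leibniz, e3, e4, ← e2]
    simp only [smul_eq_mul]
    generalize PowerSeries.derivative ℂ (bser lam w) = dA at *
    generalize PowerSeries.derivative ℂ (bser lam v) = dB at *
    generalize bser lam w = A at *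
    generalize bser lam v = B at *
    generalize PowerSeries.C w = W at *
    generalize PowerSeries.C v = V at *
    generalize PowerSeries.C (lam : ℂ) = L at *
    generalize (PowerSeries.X : PowerSeries ℂ) = x at *
    linear_combination (1 - V * x) * B * h1 + (1 - W * x) * A * h2
      - (x ^ 2 * (A * dB + B * dA) + 2 * L * x * A * B) * e1
  have hc (k : ℕ) := congrArg (PowerSeries.coeff k) hd
  simp only [add_mul, sub_mul, one_mul, map_add, map_sub, mul_assoc, PowerSeries.coeff_C_mul] at hc
  have h0 : PowerSeries.coeff 0 G = 1 := by
    simp [hG, bser, bcoef_zero]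
  have h1 : PowerSeries.coeff 1 G = 2 * lam * t := by
    have := hc 0
    simp [PowerSeries.coeff_derivative, sq, mul_assoc] at this h0 ⊢
    rw [this, h0]; ring
  have hrec (k : ℕ) : ((k : ℂ) + 2) * PowerSeries.coeff (k + 2) G
      = 2 * t * (k + 1 + lam) * PowerSeries.coeff (k + 1) G - (k + 2 * lam) * PowerSeries.coeff k G := by
    have := hc (k + 1)
    rw [sq, mul_assoc, PowerSeries.coeff_succ_X_mul, PowerSeries.coeff_succ_X_mul,
      PowerSeries.coeff_succ_X_mul, PowerSeries.coeff_derivative, PowerSeries.coeff_derivative] at this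
    rcases k with _ | k
    · simp at this ⊢
      linear_combination this
    · rw [PowerSeries.coeff_succ_X_mul, PowerSeries.coeff_derivative] at this
      push_cast at this ⊢
      linear_combination this
  have key : ∀ k, PowerSeries.coeff k G = (gegenbauer lam k t : ℂ) ∧
      PowerSeries.coeff (k + 1) G = (gegenbauer lam (k + 1) t : ℂ) := by
    intro k
    induction k with
    | zero =>
      rw [h0, zero_add, h1, gegenbauer_zero _ _ hl, gegenbauer_one _ _ hl]
      push_cast; exact ⟨rfl, rfl⟩
    | succ k ih =>
      refine ⟨ih.2, ?_⟩
      have hk : (k : ℂ) + 2 ≠ 0 := by exact_mod_cast (by positivity : (k : ℝ) + 2 ≠ 0)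
      apply mul_left_cancel₀ hk
      rw [hrec k, ih.1, ih.2]
      have := congrArg (fun x : ℝ => (x : ℂ)) (gegenbauer_rec lam t hl k)
      push_cast at this
      rw [← this]
  exact (key l).1

lemma bser_hasSum (lam : ℝ) (z : ℂ) (hz : ‖z‖ < 1) :
    Summable (fun k => ‖bcoef lam k * z ^ k‖) ∧
    HasSum (fun k => bcoef lam k * z ^ k) (1 / (1 - z) ^ (lam : ℂ)) := by
  have H := Complex.one_div_one_sub_cpow_hasFPowerSeriesOnBall_zero (lam : ℂ)
  have hz' : z ∈ Metric.eball (0 : ℂ) 1 := by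
    simpa [enorm_eq_nnnorm, ← NNReal.coe_lt_one] using hz
  constructor
  · have := FormalMultilinearSeries.summable_norm_apply _ (Metric.eball_subset_eball H.r_le hz')
    refine this.congr fun k => ?_
    simp [bcoef, FormalMultilinearSeries.ofScalars, mul_comm]
  · have := H.hasSum hz'
    rw [zero_add] at this
    have e : (fun k => bcoef lam k * z ^ k) = fun k => (FormalMultilinearSeries.ofScalars ℂ
        fun n : ℕ => Ring.choose ((lam : ℂ) + n - 1) n) k (fun _ => z) := by
      funext k
      simp [bcoef, FormalMultilinearSeries.ofScalars, mul_comm]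
    rw [e]
    exact this

lemma gen_hasSum (lam : ℝ) (hl : 0 < lam) (θ r : ℝ) (hr : |r| < 1) :
    HasSum (fun l => gegenbauer lam l (Real.cos θ) * r ^ l)
      ((1 - 2 * r * Real.cos θ + r ^ 2) ^ (-lam)) := by
  set w : ℂ := Complex.exp (θ * Complex.I) with hw
  have hw1 : ‖w‖ = 1 := Complex.norm_exp_ofReal_mul_I θ
  set v : ℂ := (starRingEnd ℂ) w with hv
  have hwv : w * v = 1 := by
    rw [hv, Complex.mul_conj, Complex.normSq_eq_norm_sq, hw1]; simp
  have hre : w.re = Real.cos θ := by rw [hw, Complex.exp_ofReal_mul_I_re]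
  have ht : w + v = 2 * (Real.cos θ : ℝ) := by
    rw [hv, Complex.add_conj, hre]; push_cast; ring
  have hv1 : ‖v‖ = 1 := by rw [hv, RCLike.norm_conj, hw1]
  have a1 := bser_hasSum lam (w * r) (by simpa [hw1] using hr)
  have a2 := bser_hasSum lam (v * r) (by simpa [hv1] using hr)
  have hs := (summable_norm_sum_mul_antidiagonal_of_summable_norm a1.1 a2.1).of_norm.hasSum
  rw [← tsum_mul_tsum_eq_tsum_sum_antidiagonal_of_summable_norm a1.1 a2.1, a1.2.tsum_eq,
    a2.2.tsum_eq] at hs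
  have hx : 1 - v * r = (starRingEnd ℂ) (1 - w * r) := by simp [hv]
  have hpos : 0 < (1 - w * r).re := by
    have : |(w * r).re| < 1 := (Complex.abs_re_le_norm _).trans_lt (by simpa [hw1] using hr)
    have := (abs_lt.1 this).2
    rw [Complex.sub_re, Complex.one_re]; linarith
  have harg : (1 - w * r).arg ≠ Real.pi := by
    intro h
    have := (Complex.arg_eq_pi_iff.1 h).1
    linarith
  have hD : 1 - 2 * r * Real.cos θ + r ^ 2 = ‖1 - w * r‖ ^ 2 := by
    have : ((1 - 2 * r * Real.cos θ + r ^ 2 : ℝ) : ℂ) = ((‖1 - w * r‖ ^ 2 : ℝ) : ℂ) := by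
      rw [← Complex.normSq_eq_norm_sq, ← Complex.mul_conj, ← hx]
      push_cast at ht ⊢
      linear_combination r * ht - r ^ 2 * hwv
    exact_mod_cast this
  have hval : 1 / (1 - w * r) ^ (lam : ℂ) * (1 / (1 - v * r) ^ (lam : ℂ))
      = (((1 - 2 * r * Real.cos θ + r ^ 2) ^ (-lam) : ℝ) : ℂ) := by
    have hc := Complex.conj_cpow (1 - w * r) (lam : ℂ) harg
    rw [Complex.conj_ofReal] at hc
    rw [hx, hc, hD, Real.rpow_neg (by positivity), ← Real.rpow_natCast, ← Real.rpow_mul (norm_nonneg _),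
      mul_comm ((2 : ℕ) : ℝ), Real.rpow_mul (norm_nonneg _), Real.rpow_natCast,
      ← Complex.norm_cpow_real, ← Complex.normSq_eq_norm_sq]
    rw [Complex.ofReal_inv, ← Complex.mul_conj, one_div, one_div, mul_inv]
  rw [hval] at hs
  rw [← Complex.hasSum_ofReal]
  refine hs.congr_fun fun l => ?_
  rw [Complex.ofReal_mul, ← prod_coeff lam hl _ w v hwv ht l, PowerSeries.coeff_mul, Finset.sum_mul]
  apply Finset.sum_congr rfl
  intro kl hkl
  rw [Finset.HasAntidiagonal.mem_antidiagonal] at hkl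
  simp only [bser, PowerSeries.coeff_mk]
  rw [← hkl, Complex.ofReal_pow]
  ring

lemma eval_hasDerivAt (p : MvPolynomial (Fin 2) ℝ) (t r : ℝ) :
    HasDerivAt (fun x => MvPolynomial.eval ![x, t] p)
      (MvPolynomial.eval ![r, t] (MvPolynomial.pderiv 0 p)) r := by
  induction p using MvPolynomial.induction_on with
  | C a => simpa using hasDerivAt_const r a
  | add p q hp hq =>
    simp only [map_add]
    exact hp.add hq
  | mul_X p i hp =>
    have hX : HasDerivAt (fun x => MvPolynomial.eval ![x, t] (MvPolynomial.X i))
        (MvPolynomial.eval ![r, t] (MvPolynomial.pderiv 0 (MvPolynomial.X i))) r := by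
      fin_cases i
      · simpa using hasDerivAt_id' r
      · simpa using hasDerivAt_const r t
    simp only [map_mul, Derivation.leibniz, smul_eq_mul, map_add]
    refine (hp.mul hX).congr_deriv ?_
    ring

lemma D_pos (θ r : ℝ) (hr : |r| < 1) : 0 < 1 - 2 * r * Real.cos θ + r ^ 2 := by
  have h1 : r * Real.cos θ ≤ |r| := by
    calc r * Real.cos θ ≤ |r * Real.cos θ| := le_abs_self _
      _ = |r| * |Real.cos θ| := abs_mul _ _
      _ ≤ |r| * 1 := by gcongr; exact Real.abs_cos_le_one θ
      _ = |r| := mul_one _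
  have h2 : r ^ 2 = |r| ^ 2 := (sq_abs r).symm
  nlinarith [sq_pos_of_pos (sub_pos.2 hr)]

lemma D_hasDerivAt (θ r e : ℝ) (hr : |r| < 1) :
    HasDerivAt (fun x => (1 - 2 * x * Real.cos θ + x ^ 2) ^ (-e))
      (-e * (2 * r - 2 * Real.cos θ) * (1 - 2 * r * Real.cos θ + r ^ 2) ^ (-(e + 1))) r := by
  have h : HasDerivAt (fun x => 1 - 2 * x * Real.cos θ + x ^ 2) (2 * r - 2 * Real.cos θ) r := by
    have h1 := (((hasDerivAt_id r).const_mul 2).mul_const (Real.cos θ)).const_sub 1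
    have h2 := h1.add (hasDerivAt_pow 2 r)
    refine h2.congr_deriv ?_
    norm_num; ring
  have := h.rpow_const (p := -e) (Or.inl (D_pos θ r hr).ne')
  refine this.congr_deriv ?_
  rw [show -e - 1 = -(e + 1) by ring]
  ring

lemma D_succ (θ r e : ℝ) (hr : |r| < 1) :
    (1 - 2 * r * Real.cos θ + r ^ 2) ^ (-e)
      = (1 - 2 * r * Real.cos θ + r ^ 2) * (1 - 2 * r * Real.cos θ + r ^ 2) ^ (-(e + 1)) := by
  have h := Real.rpow_add_one (D_pos θ r hr).ne' (-(e + 1))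
  rw [show -(e + 1) + 1 = -e by ring] at h
  rw [h]
  exact mul_comm _ _

lemma poisson_hasSum (lam : ℝ) (hl : 0 < lam) (θ r : ℝ) (hr : |r| < 1) :
    HasSum (fun l : ℕ => ((lam + l) / lam * gegenbauer lam l (Real.cos θ)) * r ^ l)
      ((1 - r ^ 2) * (1 - 2 * r * Real.cos θ + r ^ 2) ^ (-(lam + 1))) := by
  have h1 := gen_hasSum lam hl θ r hr
  have h2 := euler_hasSum _ _ _ (fun r hr => gen_hasSum lam hl θ r hr)
    (fun r hr => D_hasDerivAt θ r lam hr) r hr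
  have h3 := h1.add (h2.mul_left (1 / lam))
  rw [D_succ θ r lam hr] at h3
  have e1 : (1 - r ^ 2) * (1 - 2 * r * Real.cos θ + r ^ 2) ^ (-(lam + 1)) =
      (1 - 2 * r * Real.cos θ + r ^ 2) * (1 - 2 * r * Real.cos θ + r ^ 2) ^ (-(lam + 1)) +
      1 / lam * (r * (-lam * (2 * r - 2 * Real.cos θ) *
        (1 - 2 * r * Real.cos θ + r ^ 2) ^ (-(lam + 1)))) := by
    field_simp
    ring
  rw [e1]
  refine h3.congr_fun fun l => ?_
  field_simp

lemma wav_hasSum (n : ℕ) (hl : 0 < lamb n) (θ : ℝ) (m : ℕ) : ∀ r : ℝ, |r| < 1 →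
    HasSum (fun l : ℕ => ((l : ℝ) ^ (m + 1) * ((lamb n + l) / lamb n *
        gegenbauer (lamb n) l (Real.cos θ))) * r ^ l)
      (r * MvPolynomial.eval ![r, Real.cos θ] (Qpoly n (m + 1)) *
        (1 - 2 * r * Real.cos θ + r ^ 2) ^ (-(lamb n + m + 1 + 1))) := by
  induction m with
  | zero =>
    intro r hr
    have hd (r : ℝ) (hr : |r| < 1) := (((hasDerivAt_pow 2 r).const_sub 1).mul
      (D_hasDerivAt θ r (lamb n + 1) hr))
    have := euler_hasSum _ _ _ (fun r hr => poisson_hasSum (lamb n) hl θ r hr) hd r hr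
    rw [D_succ θ r (lamb n + 1) hr] at this
    have hQ : MvPolynomial.eval ![r, Real.cos θ] (Qpoly n (0 + 1)) =
        -((n : ℝ) + 3) * r + ((n : ℝ) - 1) * r ^ 3
          + (((n : ℝ) + 1) - ((n : ℝ) - 3) * r ^ 2) * Real.cos θ := by
      rw [zero_add, Qpoly]; simp
    have hn : (n : ℝ) = 2 * lamb n + 1 := by rw [lamb]; ring
    rw [hQ, hn]
    simp only [Nat.cast_zero, add_zero, zero_add, pow_one]
    convert this using 1
    push_cast
    ring
  | succ m ih =>
    intro r hr
    have hd (r : ℝ) (hr : |r| < 1) := (((hasDerivAt_id r).mul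
      (eval_hasDerivAt (Qpoly n (m + 1)) (Real.cos θ) r)).mul
      (D_hasDerivAt θ r (lamb n + m + 1 + 1) hr))
    have := euler_hasSum _ _ _ ih hd r hr
    rw [D_succ θ r (lamb n + m + 1 + 1) hr] at this
    have hQ : MvPolynomial.eval ![r, Real.cos θ] (Qpoly n (m + 1 + 1)) =
        (1 - (2 * lamb n + 2 * ((m : ℝ) + 1) + 1) * r ^ 2
          + (2 * (lamb n + ((m : ℝ) + 1))) * r * Real.cos θ) *
            MvPolynomial.eval ![r, Real.cos θ] (Qpoly n (m + 1)) +
        (1 + r ^ 2 - 2 * r * Real.cos θ) * r *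
          MvPolynomial.eval ![r, Real.cos θ] (MvPolynomial.pderiv 0 (Qpoly n (m + 1))) := by
      rw [Qpoly]; simp
    rw [hQ, show lamb n + ((m + 1 : ℕ) : ℝ) + 1 + 1 = lamb n + m + 1 + 1 + 1 by push_cast; ring]
    have e : ∀ l : ℕ, (l : ℝ) ^ (m + 1 + 1) * ((lamb n + l) / lamb n *
        gegenbauer (lamb n) l (Real.cos θ)) = (l : ℝ) * ((l : ℝ) ^ (m + 1) *
          ((lamb n + l) / lamb n * gegenbauer (lamb n) l (Real.cos θ))) := by
      intro l; ring
    simp only [e]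
    convert this using 1
    simp only [id_eq, Pi.mul_apply]
    ring

/-- explicit representation
`g_a^m(cos θ) = (a^m/Σ_n) r Q_m(r,cos θ)/(1-2r cos θ+r²)^{λ+m+1}` with `r = e^{-a}`,
where `Q_m` has degree at most `m` in `t` and its coefficient at `t^k` is a polynomial
in `r` of degree at most `2m-k+1` all of whose monomials `r^j` satisfy `j ≡ k-1 (mod 2)`. -/
theorem stmt5 (n m : ℕ) (hn : 2 ≤ n) (hm : 1 ≤ m) (a : ℝ) (ha : 0 < a)
    (θ : ℝ) (hθ : θ ∈ Set.Icc 0 Real.pi) :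
    pw n a m (Real.cos θ)
        = a ^ m / sigmaN n * Real.exp (-a) *
            MvPolynomial.eval ![Real.exp (-a), Real.cos θ] (Qpoly n m) /
            (1 - 2 * Real.exp (-a) * Real.cos θ + Real.exp (-a) ^ 2) ^
              (lamb n + m + 1) ∧
    ∀ d ∈ (Qpoly n m).support,
      d 1 ≤ m ∧ d 0 ≤ 2 * m - d 1 + 1 ∧ (d 0 + d 1) % 2 = 1 := by
  obtain ⟨k, rfl⟩ : ∃ k, m = k + 1 := ⟨m - 1, by omega⟩
  constructor
  · have hl : 0 < lamb n := by
      have : (2 : ℝ) ≤ n := by exact_mod_cast hn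
      rw [lamb]; linarith
    have hr : |Real.exp (-a)| < 1 := by
      rw [abs_of_pos (Real.exp_pos _)]
      rw [Real.exp_lt_one_iff]; linarith
    have h := (wav_hasSum n hl θ k _ hr).mul_left (a ^ (k + 1))
    have e : ∀ l : ℕ, ((lamb n + l) / lamb n) * (a * l) ^ (k + 1) * Real.exp (-(a * l)) *
        gegenbauer (lamb n) l (Real.cos θ) = a ^ (k + 1) * (((l : ℝ) ^ (k + 1) *
        ((lamb n + l) / lamb n * gegenbauer (lamb n) l (Real.cos θ))) * Real.exp (-a) ^ l) := by
      intro l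
      rw [← Real.exp_nat_mul, mul_pow, show (l : ℝ) * -a = -(a * l) by ring]
      ring
    rw [pw, tsum_congr e, h.tsum_eq, Real.rpow_neg (D_pos θ _ hr).le,
      show lamb n + ((k + 1 : ℕ) : ℝ) + 1 = lamb n + k + 1 + 1 by push_cast; ring]
    ring
  · intro d hd
    have := Qpoly_supOK n k d hd
    omega
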